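/- Let T : ℝ³ → ℝ^m be a linear map and let S* = {μ_T(P) : P a proper 3-system}. Then for any x, y ∈ S*, the coordinatewise minimum min{x, y} also belongs to S*. -/

import Mathlib

open Filter Set Pointwise Topology

noncomputable section

/-- Points of `ℝ^n`. -/
abbrev RVec (n : ℕ) := Fin n → ℝ

/-- The vector of `ℝ^n` with a `1` in position `j` (0-based) and `0` elsewhere;
`eVec n 0` is the first canonical basis vector `e_1`. -/
def eVec (n : ℕ) (j : ℕ) : RVec n := fun i => if (i : ℕ) = j then 1 else 0

/-- `P` is an `n`-system on the subinterval `I` of `[0,∞)`: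
`I` is an order-connected subset of `[0,∞)` with nonempty interior, and conditions
(S1), (S2), (S3) hold at every `q ∈ I`. -/
def IsNSystem (n : ℕ) (I : Set ℝ) (P : ℝ → RVec n) : Prop :=
  I ⊆ Set.Ici (0 : ℝ) ∧ I.OrdConnected ∧ (interior I).Nonempty ∧
  ∀ q ∈ I,
    ((∀ i, 0 ≤ P q i) ∧ Monotone (P q) ∧ (∑ i, P q i) = q) ∧
    ∃ ε > (0 : ℝ), ∃ k ℓ : Fin n,
      (∀ t ∈ I ∩ Set.Icc (q - ε) q, P t = P q + (t - q) • eVec n ℓ) ∧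
      (∀ t ∈ I ∩ Set.Icc q (q + ε), P t = P q + (t - q) • eVec n k) ∧
      (q ∈ interior I → ℓ < k → ∀ i : Fin n, ℓ ≤ i → i ≤ k → P q i = P q ℓ)

/-- `P` is a proper `n`-system on `I`: it is an `n`-system whose first component is
unbounded (by the monotonicity (S1) of the components, this is equivalent to all
components simultaneously exceeding any given bound). -/
def IsProperSys (n : ℕ) (I : Set ℝ) (P : ℝ → RVec n) : Prop :=
  IsNSystem n I P ∧ ∀ M : ℝ, ∃ q ∈ I, ∀ i, M < P q i

/-- The set `F(P)` of limits of `q_i⁻¹ • P(q_i)` along strictly increasing unbounded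
sequences `(q_i)` in `I`. -/
def FSet (n : ℕ) (I : Set ℝ) (P : ℝ → RVec n) : Set (RVec n) :=
  {x | ∃ q : ℕ → ℝ, (∀ i, q i ∈ I) ∧ StrictMono q ∧
    Tendsto q atTop atTop ∧ Tendsto (fun i => (q i)⁻¹ • P (q i)) atTop (𝓝 x)}

/-- The set `F(P, e₁)`: as `F(P)`, but with the extra requirement that the right
derivative of `P` at each `q_i` is the first basis vector `e_1`. -/
def FSetE1 (n : ℕ) (I : Set ℝ) (P : ℝ → RVec n) : Set (RVec n) :=
  {x | ∃ q : ℕ → ℝ, (∀ i, q i ∈ I) ∧ StrictMono q ∧ Tendsto q atTop atTop ∧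
    (∀ i, ∃ ε > (0 : ℝ), ∀ t ∈ I ∩ Set.Icc (q i) (q i + ε),
      P t = P (q i) + (t - q i) • eVec n 0) ∧
    Tendsto (fun i => (q i)⁻¹ • P (q i)) atTop (𝓝 x)}

/-- `q` is a switch number of the `n`-system `P` on `I`: a point of `I` on the boundary
of `I`, or an interior point where the local slopes `e_k` (right) and `e_ℓ` (left)
from (S2) satisfy `k < ℓ`. -/
def IsSwitchNumber (n : ℕ) (I : Set ℝ) (P : ℝ → RVec n) (q : ℝ) : Prop :=
  q ∈ I ∧ (q ∈ frontier I ∨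
    (q ∈ interior I ∧ ∃ ε > (0 : ℝ), ∃ k ℓ : Fin n, k < ℓ ∧
      (∀ t ∈ I ∩ Set.Icc (q - ε) q, P t = P q + (t - q) • eVec n ℓ) ∧
      (∀ t ∈ I ∩ Set.Icc q (q + ε), P t = P q + (t - q) • eVec n k)))

/-- `q` is a division number of the `n`-system `P` on `I`: a point of `I` on the boundary
of `I`, or an interior point where `P` is not differentiable, i.e. where the left and
right slopes from (S2) differ. -/
def IsDivisionNumber (n : ℕ) (I : Set ℝ) (P : ℝ → RVec n) (q : ℝ) : Prop :=
  q ∈ I ∧ (q ∈ frontier I ∨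
    (q ∈ interior I ∧ ∃ ε > (0 : ℝ), ∃ k ℓ : Fin n, k ≠ ℓ ∧
      (∀ t ∈ I ∩ Set.Icc (q - ε) q, P t = P q + (t - q) • eVec n ℓ) ∧
      (∀ t ∈ I ∩ Set.Icc q (q + ε), P t = P q + (t - q) • eVec n k)))

/-- A non-degenerate `n`-system: an `n`-system whose domain is a closed subinterval
of `(0,∞)` and whose switch points all have `n` distinct positive coordinates. -/
def IsNonDegenerate (n : ℕ) (I : Set ℝ) (P : ℝ → RVec n) : Prop :=
  IsNSystem n I P ∧ IsClosed I ∧ I ⊆ Set.Ioi (0 : ℝ) ∧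
  ∀ q, IsSwitchNumber n I P q → (∀ i, 0 < P q i) ∧ StrictMono (P q)

/-- A rigid `n`-system of mesh `δ`: a non-degenerate `n`-system whose switch points
belong to `δℤ^n`. -/
def IsRigid (n : ℕ) (δ : ℝ) (I : Set ℝ) (P : ℝ → RVec n) : Prop :=
  IsNonDegenerate n I P ∧
  ∀ q, IsSwitchNumber n I P q → ∀ i, ∃ m : ℤ, P q i = δ * m

/-- A self-similar system: the domain is unbounded and there is `ρ > 1` with
`P(ρq) = ρ • P(q)` for all `q` in the domain. -/
def IsSelfSimilar (n : ℕ) (I : Set ℝ) (P : ℝ → RVec n) : Prop :=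
  ¬ BddAbove I ∧ ∃ ρ : ℝ, 1 < ρ ∧ ∀ q ∈ I, ρ * q ∈ I ∧ P (ρ * q) = ρ • P q

/-- The cube `[-ε, ε]^n`. -/
def cubeNbhd (n : ℕ) (ε : ℝ) : Set (RVec n) := {y | ∀ i, |y i| ≤ ε}

/-- The distance `dist(E, F)`: the infimum of all `ε > 0` such that
`E ⊆ F + [-ε,ε]^n` and `F ⊆ E + [-ε,ε]^n`. -/
def cubeDist (n : ℕ) (E F : Set (RVec n)) : ℝ :=
  sInf {ε : ℝ | 0 < ε ∧ E ⊆ F + cubeNbhd n ε ∧ F ⊆ E + cubeNbhd n ε}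

/-- `μ_T(P)`: the point of `ℝ^m` whose `j`-th coordinate is
`liminf_{q → ∞, q ∈ I} T_j(P(q))/q`. -/
def muT (n m : ℕ) (T : RVec n → RVec m) (I : Set ℝ) (P : ℝ → RVec n) : RVec m :=
  fun j => Filter.liminf (fun q => T (P q) j / q) (atTop ⊓ 𝓟 I)

/-- `liminf` of a sequence of subsets of `ℝ^n`: the set of limits of convergent
sequences `(x_i)` with `x_i ∈ F i` for every `i`. -/
def setLiminf (n : ℕ) (F : ℕ → Set (RVec n)) : Set (RVec n) :=
  {x | ∃ y : ℕ → RVec n, (∀ i, y i ∈ F i) ∧ Tendsto y atTop (𝓝 x)}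

/-- `limsup` of a sequence of subsets of `ℝ^n`: the set of accumulation points of
sequences `(x_i)` with `x_i ∈ F i` for every `i`, i.e. limits of convergent
subsequences. -/
def setLimsup (n : ℕ) (F : ℕ → Set (RVec n)) : Set (RVec n) :=
  {x | ∃ (y : ℕ → RVec n) (φ : ℕ → ℕ), (∀ i, y i ∈ F i) ∧ StrictMono φ ∧
    Tendsto (y ∘ φ) atTop (𝓝 x)}

/-- The point `w` has ordered nonnegative coordinates with sum `q`. -/
def IsOrderedPoint (w : RVec 3) (q : ℝ) : Prop :=
  (∀ i, 0 ≤ w i) ∧ Monotone w ∧ ∑ i, w i = q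

/-- Just before `q`, the map `P` moves along its coordinate of index `l`. -/
def HasLeftSlope (P : ℝ → RVec 3) (q : ℝ) (l : Fin 3) : Prop :=
  ∀ᶠ t in 𝓝[≤] q, P t = P q + (t - q) • eVec 3 l

/-- Just after `q`, the map `P` moves along its coordinate of index `k`. -/
def HasRightSlope (P : ℝ → RVec 3) (q : ℝ) (k : Fin 3) : Prop :=
  ∀ᶠ t in 𝓝[≥] q, P t = P q + (t - q) • eVec 3 k

/-- A `3`-system may pass at `w` from moving the coordinate `l` to moving the coordinate `k`. -/
def SlopeChange (w : RVec 3) (l k : Fin 3) : Prop :=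
  l < k → ∀ i, l ≤ i → i ≤ k → w i = w l

/-- The map `P` satisfies the defining conditions of a `3`-system at the interior point `q`. -/
def IsSystemAt (P : ℝ → RVec 3) (q : ℝ) : Prop :=
  IsOrderedPoint (P q) q ∧
    ∃ k l, HasLeftSlope P q l ∧ HasRightSlope P q k ∧ SlopeChange (P q) l k

lemma eVec_fin_apply (k i : Fin 3) : eVec 3 k i = if i = k then 1 else 0 := by
  simp [eVec, Fin.ext_iff]

lemma isOrderedPoint_iff {w : RVec 3} {q : ℝ} :
    IsOrderedPoint w q ↔ 0 ≤ w 0 ∧ w 0 ≤ w 1 ∧ w 1 ≤ w 2 ∧ w 0 + w 1 + w 2 = q := by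
  constructor
  · rintro ⟨h0, hm, hs⟩
    rw [Fin.sum_univ_three] at hs
    exact ⟨h0 0, hm (by decide), hm (by decide), hs⟩
  · rintro ⟨h0, h1, h2, hs⟩
    refine ⟨fun i => ?_, fun i j hij => ?_, by rw [Fin.sum_univ_three]; exact hs⟩
    · fin_cases i <;> simp <;> linarith
    · fin_cases i <;> fin_cases j <;> simp at hij ⊢ <;> linarith

lemma HasLeftSlope.congr {P Q : ℝ → RVec 3} {q : ℝ} {l : Fin 3} (h : HasLeftSlope P q l)
    (hPQ : Q =ᶠ[𝓝[≤] q] P) : HasLeftSlope Q q l := by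
  have hq : Q q = P q := hPQ.self_of_nhdsWithin self_mem_Iic
  filter_upwards [h, hPQ] with t ht ht'
  rw [ht', ht, hq]

lemma HasRightSlope.congr {P Q : ℝ → RVec 3} {q : ℝ} {l : Fin 3} (h : HasRightSlope P q l)
    (hPQ : Q =ᶠ[𝓝[≥] q] P) : HasRightSlope Q q l := by
  have hq : Q q = P q := hPQ.self_of_nhdsWithin self_mem_Ici
  filter_upwards [h, hPQ] with t ht ht'
  rw [ht', ht, hq]

lemma IsSystemAt.congr {P Q : ℝ → RVec 3} {q : ℝ} (h : IsSystemAt P q)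
    (hPQ : Q =ᶠ[𝓝 q] P) : IsSystemAt Q q := by
  obtain ⟨h1, k, l, hl, hk, hc⟩ := h
  have hq : Q q = P q := hPQ.self_of_nhds
  refine ⟨hq ▸ h1, k, l, hl.congr (hPQ.filter_mono nhdsWithin_le_nhds),
    hk.congr (hPQ.filter_mono nhdsWithin_le_nhds), hq ▸ hc⟩

lemma IsSystemAt.continuousAt {P : ℝ → RVec 3} {q : ℝ} (h : IsSystemAt P q) :
    ContinuousAt P q := by
  obtain ⟨-, k, l, hl, hk, -⟩ := h
  rw [continuousAt_iff_continuous_left_right]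
  constructor
  · refine ContinuousWithinAt.congr_of_eventuallyEq (f := fun t => P q + (t - q) • eVec 3 l)
      (by fun_prop) hl (by simp)
  · refine ContinuousWithinAt.congr_of_eventuallyEq (f := fun t => P q + (t - q) • eVec 3 k)
      (by fun_prop) hk (by simp)

lemma IsOrderedPoint.smul {w : RVec 3} {q c : ℝ} (hc : 0 ≤ c) (h : IsOrderedPoint w q) :
    IsOrderedPoint (c • w) (c * q) := by
  rw [isOrderedPoint_iff] at h ⊢
  obtain ⟨h0, h1, h2, hs⟩ := h
  simp only [Pi.smul_apply, smul_eq_mul]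
  refine ⟨by positivity, by gcongr, by gcongr, by rw [← hs]; ring⟩

lemma IsSystemAt.rescale {P : ℝ → RVec 3} {q c : ℝ} (hc : 0 < c) (h : IsSystemAt P q) :
    IsSystemAt (fun t => c • P (t / c)) (c * q) := by
  obtain ⟨h1, k, l, hl, hk, hch⟩ := h
  have hq : c * q / c = q := by field_simp
  refine ⟨by simpa only [hq] using h1.smul hc.le, k, l, ?_, ?_, ?_⟩
  · have ht : Tendsto (fun t => t / c) (𝓝[≤] (c * q)) (𝓝[≤] q) := by
      refine tendsto_nhdsWithin_iff.2 ⟨?_, ?_⟩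
      · have : Tendsto (fun t : ℝ => t / c) (𝓝 (c * q)) (𝓝 (c * q / c)) :=
          (continuous_id.div_const c).tendsto _
        rw [hq] at this
        exact this.mono_left nhdsWithin_le_nhds
      · filter_upwards [self_mem_nhdsWithin] with t ht
        rw [mem_Iic, div_le_iff₀ hc, mul_comm]
        exact ht
    filter_upwards [ht.eventually hl] with t ht
    simp only [hq]
    rw [ht, smul_add, smul_smul]
    congr 2
    field_simp
  · have ht : Tendsto (fun t => t / c) (𝓝[≥] (c * q)) (𝓝[≥] q) := by
      refine tendsto_nhdsWithin_iff.2 ⟨?_, ?_⟩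
      · have : Tendsto (fun t : ℝ => t / c) (𝓝 (c * q)) (𝓝 (c * q / c)) :=
          (continuous_id.div_const c).tendsto _
        rw [hq] at this
        exact this.mono_left nhdsWithin_le_nhds
      · filter_upwards [self_mem_nhdsWithin] with t ht
        rw [mem_Ici, le_div_iff₀ hc, mul_comm]
        exact ht
    filter_upwards [ht.eventually hk] with t ht
    simp only [hq]
    rw [ht, smul_add, smul_smul]
    congr 2
    field_simp
  · intro hlk i hi hi'
    simp only [hq, Pi.smul_apply]
    rw [hch hlk i hi hi']

/-- Along a system, every coordinate is nondecreasing. -/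
lemma monotoneOn_apply_of_isSystemAt {P : ℝ → RVec 3} {a : ℝ} (h : ∀ q > a, IsSystemAt P q)
    (i : Fin 3) : MonotoneOn (fun t => P t i) (Ioi a) := by
  intro s hs t ht hst
  have hcont : ContinuousOn (fun t => P t i) (Icc s t) := fun x hx =>
    ((continuous_apply i).continuousAt.comp
      (h x (lt_of_lt_of_le hs hx.1)).continuousAt).continuousWithinAt
  have hcl : IsClosed ({x | P s i ≤ P x i} ∩ Icc s t) := by
    have := hcont.preimage_isClosed_of_isClosed isClosed_Icc (isClosed_Ici (a := P s i))
    rwa [inter_comm] at this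
  refine (hcl.Icc_subset_of_forall_mem_nhdsWithin (by simp) fun x hx => ?_) ⟨hst, le_rfl⟩
  obtain ⟨-, k, l, -, hk, -⟩ := h x (lt_of_lt_of_le hs hx.2.1)
  filter_upwards [hk.filter_mono (nhdsWithin_mono x Ioi_subset_Ici_self), self_mem_nhdsWithin]
    with y hy hxy
  have h1 : P s i ≤ P x i := hx.1
  simp only [hy, Pi.add_apply, Pi.smul_apply, smul_eq_mul, eVec_fin_apply]
  have : x < y := hxy
  split_ifs <;> linarith

/-- A coordinate which is never the moving one stays constant. -/
lemma apply_eq_of_forall_not_hasRightSlope {P : ℝ → RVec 3} {a s t : ℝ}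
    (h : ∀ q > a, IsSystemAt P q) (hs : a < s) (hst : s ≤ t) (i : Fin 3)
    (hi : ∀ x ∈ Ico s t, ¬ HasRightSlope P x i) : P t i = P s i := by
  refine le_antisymm ?_ (monotoneOn_apply_of_isSystemAt h i hs (lt_of_lt_of_le hs hst) hst)
  have hcont : ContinuousOn (fun t => P t i) (Icc s t) := fun x hx =>
    ((continuous_apply i).continuousAt.comp
      (h x (lt_of_lt_of_le hs hx.1)).continuousAt).continuousWithinAt
  have hcl : IsClosed ({x | P x i ≤ P s i} ∩ Icc s t) := by
    have := hcont.preimage_isClosed_of_isClosed isClosed_Icc (isClosed_Iic (a := P s i))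
    rwa [inter_comm] at this
  refine (hcl.Icc_subset_of_forall_mem_nhdsWithin (by simp) fun x hx => ?_) ⟨hst, le_rfl⟩
  obtain ⟨-, k, l, -, hk, -⟩ := h x (lt_of_lt_of_le hs hx.2.1)
  have hki : i ≠ k := fun e => hi x hx.2 (e ▸ hk)
  filter_upwards [hk.filter_mono (nhdsWithin_mono x Ioi_subset_Ici_self)] with y hy
  have h1 : P x i ≤ P s i := hx.1
  simpa [hy, eVec_fin_apply, hki] using h1

/-- As long as `P_{j-1} < P_j`, a moving coordinate of index `< j` keeps the coordinates of index
`≥ j` constant. -/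
lemma apply_eq_of_hasRightSlope {P : ℝ → RVec 3} {a s t : ℝ}
    (h : ∀ q > a, IsSystemAt P q) (hs : a < s) (hst : s ≤ t) {k j j' : Fin 3}
    (hj : (j' : ℕ) + 1 = j) (hk : HasRightSlope P s k) (hkj : k < j)
    (hlt : ∀ x ∈ Ioo s t, P x j' < P x j) : ∀ i, j ≤ i → P t i = P s i := by
  have hmono := monotoneOn_apply_of_isSystemAt h
  suffices hsub : Icc s t ⊆ {x | ∀ i, j ≤ i → P x i ≤ P s i} from fun i hi =>
    le_antisymm (hsub ⟨hst, le_rfl⟩ i hi) (hmono i hs (lt_of_lt_of_le hs hst) hst)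
  have hcont : ∀ i, ContinuousOn (fun t => P t i) (Icc s t) := fun i x hx =>
    ((continuous_apply i).continuousAt.comp
      (h x (lt_of_lt_of_le hs hx.1)).continuousAt).continuousWithinAt
  have hcl : IsClosed ({x | ∀ i, j ≤ i → P x i ≤ P s i} ∩ Icc s t) := by
    have : {x | ∀ i, j ≤ i → P x i ≤ P s i} ∩ Icc s t
        = Icc s t ∩ ⋂ i, ⋂ (_ : j ≤ i), Icc s t ∩ (fun t => P t i) ⁻¹' Iic (P s i) := by
      ext x
      simp only [mem_inter_iff, mem_ofPred_eq, mem_iInter, mem_preimage, mem_Iic]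
      exact ⟨fun h => ⟨h.2, fun i hi => ⟨h.2, h.1 i hi⟩⟩, fun h => ⟨fun i hi => (h.2 i hi).2, h.1⟩⟩
    rw [this]
    exact isClosed_Icc.inter (isClosed_iInter fun i => isClosed_iInter fun _ =>
      (hcont i).preimage_isClosed_of_isClosed isClosed_Icc isClosed_Iic)
  refine hcl.Icc_subset_of_forall_mem_nhdsWithin (by simp) fun x hx => ?_
  suffices hx' : ∃ k, HasRightSlope P x k ∧ k < j by
    obtain ⟨k', hk', hkj'⟩ := hx'
    filter_upwards [hk'.filter_mono (nhdsWithin_mono x Ioi_subset_Ici_self)] with y hy i hi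
    have h1 : P x i ≤ P s i := hx.1 i hi
    simpa [hy, eVec_fin_apply, (hkj'.trans_le hi).ne'] using h1
  rcases hx.2.1.eq_or_lt with rfl | hsx
  · exact ⟨k, hk, hkj⟩
  obtain ⟨-, k', l, hl, hk', hc⟩ := h x (hs.trans hsx)
  refine ⟨k', hk', ?_⟩
  by_contra! hjk
  have hlj : l < j := by
    by_contra! hjl
    have h1 : ∀ᶠ y in 𝓝[<] x, P y = P x + (y - x) • eVec 3 l :=
      hl.filter_mono (nhdsWithin_mono x Iio_subset_Iic_self)
    have h2 : ∀ᶠ y in 𝓝[<] x, y ∈ Ioo s x := Ioo_mem_nhdsLT hsx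
    obtain ⟨y, hy1, hy2⟩ := (h1.and h2).exists
    have h3 : P x l ≤ P s l := hx.1 l hjl
    have h4 := hmono l hs (hs.trans hy2.1) hy2.1.le
    simp [hy1, eVec_fin_apply] at h4
    linarith [hy2.2]
  have hl' : l ≤ j' := by rw [Fin.lt_def] at hlj; rw [Fin.le_def]; omega
  have hj'j : j' ≤ j := by rw [Fin.le_def]; omega
  have := hlt x ⟨hsx, hx.2.2⟩
  rw [hc (hlj.trans_le hjk) j' hl' (hj'j.trans hjk), hc (hlj.trans_le hjk) j hlj.le hjk] at this
  exact lt_irrefl _ this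

/-- On `(a, ∞)` the map `P` is a `3`-system with unbounded first component. -/
def IsProperTail (P : ℝ → RVec 3) (a : ℝ) : Prop :=
  (∀ q > a, IsSystemAt P q) ∧ ∀ M, ∃ q > a, M < P q 0

lemma IsSystemAt.le {P : ℝ → RVec 3} {q : ℝ} (h : IsSystemAt P q) :
    0 ≤ P q 0 ∧ P q 0 ≤ P q 1 ∧ P q 1 ≤ P q 2 ∧ P q 0 + P q 1 + P q 2 = q :=
  isOrderedPoint_iff.1 h.1

namespace IsProperTail

variable {P : ℝ → RVec 3} {a : ℝ}

lemma eventually_lt_apply (h : IsProperTail P a) (M : ℝ) (i : Fin 3) :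
    ∀ᶠ q in atTop, M < P q i := by
  obtain ⟨q, hq, hM⟩ := h.2 M
  filter_upwards [eventually_ge_atTop q] with t ht
  have h1 := monotoneOn_apply_of_isSystemAt h.1 0 hq (lt_of_lt_of_le hq ht) ht
  exact (hM.trans_le h1).trans_le ((h.1 t (lt_of_lt_of_le hq ht)).1.2.1 (Fin.zero_le i))

lemma continuousOn_apply (h : IsProperTail P a) (i : Fin 3) :
    ContinuousOn (fun t => P t i) (Ioi a) := fun x hx =>
  ((continuous_apply i).continuousAt.comp (h.1 x hx).continuousAt).continuousWithinAt

lemma exists_hasRightSlope_zero (h : IsProperTail P a) {N : ℝ} (hN : a < N) :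
    ∃ t ≥ N, HasRightSlope P t 0 := by
  by_contra! hcon
  obtain ⟨t, ht, htN⟩ := ((h.eventually_lt_apply (P N 0) 0).and (eventually_ge_atTop N)).exists
  exact ht.ne' (apply_eq_of_forall_not_hasRightSlope h.1 hN htN 0 fun x hx => hcon x hx.1)

/-- Two consecutive coordinates of a proper system coincide at arbitrarily large times. -/
lemma exists_apply_eq (h : IsProperTail P a) {j j' : Fin 3} (hj : (j' : ℕ) + 1 = j) (N : ℝ) :
    ∃ t ≥ N, P t j' = P t j := by
  by_contra! hcon
  set N' := max N (a + 1)
  have hN' : a < N' := lt_of_lt_of_le (lt_add_one a) (le_max_right _ _)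
  obtain ⟨t, ht, hk⟩ := h.exists_hasRightSlope_zero hN'
  have hat : a < t := hN'.trans_le ht
  obtain ⟨s, hs, hts⟩ := ((h.eventually_lt_apply (P t j) j).and (eventually_ge_atTop t)).exists
  have hjj : j' ≤ j := by rw [Fin.le_def]; omega
  refine hs.ne' (apply_eq_of_hasRightSlope h.1 hat hts hj hk ?_ ?_ j le_rfl)
  · rw [Fin.lt_def, ← hj]; simp
  · intro x hx
    exact lt_of_le_of_ne ((h.1 x (hat.trans hx.1)).1.2.1 hjj)
      (hcon x ((le_max_left _ _).trans (ht.trans hx.1.le)))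

/-- At arbitrarily large times, a proper system goes from a point with `P_1 = P_2` to a point with
`P_2 = P_3` while `P_1` and `P_3` keep their values. -/
lemma exists_crossing (h : IsProperTail P a) (N : ℝ) :
    ∃ u v, N ≤ u ∧ a < u ∧ u ≤ v ∧ P u 0 = P u 1 ∧ P v 1 = P v 2 ∧ P u 0 = P v 0 ∧
      P u 2 = P v 2 := by
  obtain ⟨u₀, hu₀, hu₀e⟩ := h.exists_apply_eq (j := 1) (j' := 0) rfl (max N (a + 1))
  have hNu₀ : N ≤ u₀ := (le_max_left _ _).trans hu₀
  have hau₀ : a < u₀ := lt_of_lt_of_le (lt_add_one a) ((le_max_right _ _).trans hu₀)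
  have hcl : ∀ (i j : Fin 3) (b : ℝ), IsClosed (Icc u₀ b ∩ {t | P t i = P t j}) := by
    intro i j b
    have h1 : ContinuousOn (fun t => P t i - P t j) (Icc u₀ b) :=
      ((h.continuousOn_apply i).sub (h.continuousOn_apply j)).mono fun x hx =>
        lt_of_lt_of_le hau₀ hx.1
    convert h1.preimage_isClosed_of_isClosed isClosed_Icc (isClosed_singleton (x := (0 : ℝ)))
      using 2
    ext t
    simp [sub_eq_zero]
  obtain ⟨v₀, hv₀, hv₀e⟩ := h.exists_apply_eq (j := 2) (j' := 1) rfl u₀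
  set V := Icc u₀ v₀ ∩ {t | P t 1 = P t 2}
  have hVb : BddBelow V := ⟨u₀, fun x hx => hx.1.1⟩
  obtain ⟨hv1, hv2⟩ : sInf V ∈ V := (hcl 1 2 v₀).csInf_mem ⟨v₀, ⟨hv₀, le_rfl⟩, hv₀e⟩ hVb
  set v := sInf V
  have hv : ∀ x ∈ Ico u₀ v, P x 1 < P x 2 := by
    intro x hx
    refine lt_of_le_of_ne (h.1 x (lt_of_lt_of_le hau₀ hx.1)).le.2.2.1 fun e => ?_
    exact not_le.2 hx.2 (csInf_le hVb ⟨⟨hx.1, hx.2.le.trans hv1.2⟩, e⟩)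
  set U := Icc u₀ v ∩ {t | P t 0 = P t 1}
  have hUb : BddAbove U := ⟨v, fun x hx => hx.1.2⟩
  obtain ⟨hu1, hu2⟩ : sSup U ∈ U := (hcl 0 1 v).csSup_mem ⟨u₀, ⟨le_rfl, hv1.1⟩, hu₀e⟩ hUb
  set u := sSup U
  have hau : a < u := lt_of_lt_of_le hau₀ hu1.1
  have hu : ∀ x ∈ Ioc u v, P x 0 < P x 1 := by
    intro x hx
    refine lt_of_le_of_ne (h.1 x (hau.trans hx.1)).le.2.1 fun e => ?_
    exact not_le.2 hx.1 (le_csSup hUb ⟨⟨hu1.1.trans hx.1.le, hx.2⟩, e⟩)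
  refine ⟨u, v, hNu₀.trans hu1.1, hau, hu1.2, hu2, hv2, ?_, ?_⟩
  · refine (apply_eq_of_forall_not_hasRightSlope h.1 hau hu1.2 0 fun x hx hx0 => ?_).symm
    have hxa : a < x := lt_of_lt_of_le hau hx.1
    have h1 := apply_eq_of_hasRightSlope h.1 hxa hx.2.le (j' := 0) (j := 1) rfl hx0 (by decide)
      fun y hy => hu y ⟨lt_of_le_of_lt hx.1 hy.1, hy.2.le⟩
    have h2 := hv x ⟨hu1.1.trans hx.1, hx.2⟩
    rw [← h1 1 le_rfl, ← h1 2 (by decide), hv2] at h2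
    exact lt_irrefl _ h2
  · rcases hu1.2.eq_or_lt with huv | huv
    · rw [huv]
    obtain ⟨-, k, l, -, hk, -⟩ := h.1 u hau
    refine (apply_eq_of_hasRightSlope h.1 hau hu1.2 (j' := 1) (j := 2) rfl hk ?_ ?_ 2 le_rfl).symm
    · by_contra! hk2
      obtain rfl : k = 2 := by omega
      have h1 : ∀ᶠ y in 𝓝[>] u, P y = P u + (y - u) • eVec 3 (2 : Fin 3) :=
        hk.filter_mono (nhdsWithin_mono u Ioi_subset_Ici_self)
      obtain ⟨y, hy1, hy2⟩ := (h1.and (Ioc_mem_nhdsGT huv)).exists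
      have h3 := hu y hy2
      simp [hy1, eVec] at h3
      have h4 : P u 0 = P u 1 := hu2
      linarith
    · exact fun x hx => hv x ⟨hu1.1.trans hx.1.le, hx.2⟩

end IsProperTail

/-- `W` restricted to `[a, b]` is a `3`-system with values in `G`, which may follow a system moving
the coordinate `l` at the end, and which itself moves the last given coordinate at the end. -/
structure IsArc (G : Set (RVec 3)) (W : ℝ → RVec 3) (a b : ℝ) (l l' : Fin 3) : Prop where
  lt : a < b
  mem : ∀ q ∈ Icc a b, W q ∈ G
  left : IsOrderedPoint (W a) a
  right : IsOrderedPoint (W b) b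
  interior : ∀ q ∈ Ioo a b, IsSystemAt W q
  start : ∃ k, HasRightSlope W a k ∧ SlopeChange (W a) l k
  final : HasLeftSlope W b l'

namespace IsArc

variable {G : Set (RVec 3)} {W W' R : ℝ → RVec 3} {a b c : ℝ} {l l' l'' : Fin 3}

lemma isSystemAt_junction (h : IsArc G W a b l l') {G' : Set (RVec 3)}
    (h' : IsArc G' W' b c l' l'')
    (hR : EqOn R W (Icc a b)) (hR' : EqOn R W' (Icc b c)) : IsSystemAt R b := by
  obtain ⟨k, hk, hc⟩ := h'.start
  have hb : R b = W' b := hR' ⟨le_rfl, h'.lt.le⟩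
  refine ⟨hb ▸ h'.left, k, l', h.final.congr ?_, hk.congr ?_, hb ▸ hc⟩
  · exact hR.eventuallyEq_of_mem (Icc_mem_nhdsLE h.lt)
  · exact hR'.eventuallyEq_of_mem (Icc_mem_nhdsGE h'.lt)

lemma isSystemAt_of_eqOn (h : IsArc G W a b l l') (hR : EqOn R W (Icc a b)) {q : ℝ}
    (hq : q ∈ Ioo a b) : IsSystemAt R q :=
  (h.interior q hq).congr (hR.eventuallyEq_of_mem (Icc_mem_nhds hq.1 hq.2))

lemma exists_trans (h : IsArc G W a b l l') (h' : IsArc G W' b c l' l'') (hb : W b = W' b) :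
    ∃ R, IsArc G R a c l l'' ∧ EqOn R W (Icc a b) ∧ EqOn R W' (Icc b c) := by
  set R : ℝ → RVec 3 := fun t => if t ≤ b then W t else W' t
  have hR : EqOn R W (Icc a b) := fun t ht => if_pos ht.2
  have hR' : EqOn R W' (Icc b c) := by
    intro t ht
    rcases ht.1.eq_or_lt with rfl | hbt
    · exact (if_pos le_rfl).trans hb
    · exact if_neg (not_le.2 hbt)
  have ha : R a = W a := hR ⟨le_rfl, h.lt.le⟩
  have hc : R c = W' c := hR' ⟨h'.lt.le, le_rfl⟩
  refine ⟨R, ⟨h.lt.trans h'.lt, fun q hq => ?_, ha ▸ h.left, hc ▸ h'.right, fun q hq => ?_, ?_, ?_⟩,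
    hR, hR'⟩
  · rcases le_total q b with hqb | hqb
    · rw [hR ⟨hq.1, hqb⟩]; exact h.mem q ⟨hq.1, hqb⟩
    · rw [hR' ⟨hqb, hq.2⟩]; exact h'.mem q ⟨hqb, hq.2⟩
  · rcases lt_trichotomy q b with hqb | rfl | hqb
    · exact h.isSystemAt_of_eqOn hR ⟨hq.1, hqb⟩
    · exact h.isSystemAt_junction h' hR hR'
    · exact h'.isSystemAt_of_eqOn hR' ⟨hqb, hq.2⟩
  · obtain ⟨k, hk, hkl⟩ := h.start
    exact ⟨k, hk.congr (hR.eventuallyEq_of_mem (Icc_mem_nhdsGE h.lt)), ha ▸ hkl⟩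
  · exact h'.final.congr (hR'.eventuallyEq_of_mem (Icc_mem_nhdsLE h'.lt))

end IsArc

/-- A `3`-system with values in `G`, possibly reduced to a point, leads from `p` (reached with
slope `e_l`) to `p'` (reached with slope `e_l'`), passing through all points of `V`. -/
def Joins (G V : Set (RVec 3)) (p : RVec 3) (l : Fin 3) (p' : RVec 3) (l' : Fin 3) : Prop :=
  (p = p' ∧ l = l' ∧ V = ∅) ∨
    ∃ W a b, IsArc G W a b l l' ∧ W a = p ∧ W b = p' ∧ V ⊆ W '' Icc a b

lemma Joins.refl (G : Set (RVec 3)) (p : RVec 3) (l : Fin 3) : Joins G ∅ p l p l :=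
  Or.inl ⟨rfl, rfl, rfl⟩

lemma Joins.trans {G V V' : Set (RVec 3)} {p p' p'' : RVec 3} {l l' l'' : Fin 3}
    (h : Joins G V p l p' l') (h' : Joins G V' p' l' p'' l'') :
    Joins G (V ∪ V') p l p'' l'' := by
  rcases h with ⟨rfl, rfl, rfl⟩ | ⟨W, a, b, hW, rfl, rfl, hV⟩
  · simpa using h'
  rcases h' with ⟨rfl, rfl, rfl⟩ | ⟨W', b', c, hW', hb, rfl, hV'⟩
  · exact Or.inr ⟨W, a, b, hW, rfl, rfl, by simpa using hV⟩
  obtain rfl : b' = b := by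
    rw [← hW'.left.2.2, ← hW.right.2.2, hb]
  obtain ⟨R, hR, h1, h2⟩ := hW.exists_trans hW' hb.symm
  refine Or.inr ⟨R, a, c, hR, h1 ⟨le_rfl, hW.lt.le⟩, h2 ⟨hW'.lt.le, le_rfl⟩, ?_⟩
  rintro w (hw | hw)
  · obtain ⟨t, ht, rfl⟩ := hV hw
    exact ⟨t, ⟨ht.1, ht.2.trans hW'.lt.le⟩, h1 ht⟩
  · obtain ⟨t, ht, rfl⟩ := hV' hw
    exact ⟨t, ⟨hW.lt.le.trans ht.1, ht.2⟩, h2 ht⟩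

/-- Moving the single coordinate of index `k`. -/
lemma joins_add_smul {G : Set (RVec 3)} (hG : Convex ℝ G) {p p' : RVec 3} {l k : Fin 3} {s : ℝ}
    (hs : 0 < s) (hp' : p' = p + s • eVec 3 k) (hp : p ∈ G) (hpG : p' ∈ G)
    (ho : ∃ q, IsOrderedPoint p q) (ho' : ∃ q, IsOrderedPoint p' q) (hc : SlopeChange p l k) :
    Joins G ∅ p l p' k := by
  subst hp'
  obtain ⟨q, ho⟩ := ho
  obtain ⟨q', ho'⟩ := ho'
  have he : ∑ i, eVec 3 k i = 1 := by simp [eVec_fin_apply]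
  obtain rfl : q' = q + s := by
    have h := ho'.2.2
    simp only [Pi.add_apply, Pi.smul_apply, smul_eq_mul, Finset.sum_add_distrib,
      ← Finset.mul_sum, he, ho.2.2, mul_one] at h
    exact h.symm
  set W : ℝ → RVec 3 := fun t => p + (t - q) • eVec 3 k
  have hq : W q = p := by simp [W]
  have hq' : W (q + s) = p + s • eVec 3 k := by simp [W]
  have hslope : ∀ x t, W t = W x + (t - x) • eVec 3 k := by
    intro x t
    simp only [W]
    module
  have hW : ∀ t ∈ Icc q (q + s), W t ∈ G ∧ IsOrderedPoint (W t) t := by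
    intro t ht
    have h1 : 0 ≤ (t - q) / s := div_nonneg (by linarith [ht.1]) hs.le
    have h2 : 0 ≤ 1 - (t - q) / s := by
      rw [sub_nonneg, div_le_one hs]; linarith [ht.2]
    have h3 : W t = (1 - (t - q) / s) • p + ((t - q) / s) • (p + s • eVec 3 k) := by
      simp only [W, smul_add, smul_smul, div_mul_cancel₀ _ hs.ne']
      module
    refine ⟨h3 ▸ hG hp hpG h2 h1 (by ring), ?_⟩
    obtain ⟨a0, a1, a2, a3⟩ := isOrderedPoint_iff.1 ho
    obtain ⟨b0, b1, b2, b3⟩ := isOrderedPoint_iff.1 ho'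
    rw [isOrderedPoint_iff, h3]
    generalize p + s • eVec 3 k = p' at *
    simp only [Pi.add_apply, Pi.smul_apply, smul_eq_mul]
    refine ⟨by positivity, by gcongr, by gcongr, ?_⟩
    calc _ = (1 - (t - q) / s) * (p 0 + p 1 + p 2) + (t - q) / s * (p' 0 + p' 1 + p' 2) := by ring
      _ = t := by rw [a3, b3]; field_simp; ring
  refine Or.inr ⟨W, q, q + s, ⟨by linarith, fun t ht => (hW t ht).1, hq ▸ ho, hq' ▸ ho',
    fun t ht => ⟨(hW t ⟨ht.1.le, ht.2.le⟩).2, k, k, ?_, ?_, fun h => (lt_irrefl _ h).elim⟩,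
    ⟨k, ?_, hq ▸ hc⟩, ?_⟩, hq, hq', empty_subset _⟩
  all_goals exact Eventually.of_forall fun t => hslope _ t

/-- A slope after which every slope is allowed. -/
def IsFree (p : RVec 3) (l : Fin 3) : Prop := ∀ k, SlopeChange p l k

lemma joins_of_isSystemAt {G : Set (RVec 3)} {P : ℝ → RVec 3} {a s t : ℝ} {l : Fin 3}
    (h : ∀ q > a, IsSystemAt P q) (hs : a < s) (hst : s < t) (hG : ∀ q ∈ Icc s t, P q ∈ G)
    (hl : IsFree (P s) l) : ∃ l', Joins G (P '' Icc s t) (P s) l (P t) l' := by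
  obtain ⟨h1, k, -, -, hk, -⟩ := h s hs
  obtain ⟨h2, -, l', hl', -, -⟩ := h t (hs.trans hst)
  exact ⟨l', Or.inr ⟨P, s, t,
    ⟨hst, hG, h1, h2, fun q hq => h q (hs.trans hq.1), ⟨k, hk, hl k⟩, hl'⟩, rfl, rfl, Subset.rfl⟩⟩

lemma rel_of_forall_close {r : ℝ → ℝ → Prop} (hr : ∀ x, r x x)
    (ht : ∀ x y z, r x y → r y z → r x z) {α β δ : ℝ} (hαβ : α ≤ β) (hδ : 0 < δ)
    (h : ∀ x y, α ≤ x → x < y → y ≤ β → y - x < δ → r x y) : r α β := by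
  rcases hαβ.eq_or_lt with rfl | hlt
  · exact hr _
  obtain ⟨n, hn⟩ := exists_nat_gt ((β - α) / δ)
  have hn0 : (0 : ℝ) < n := lt_of_le_of_lt (div_nonneg (sub_nonneg.2 hαβ) hδ.le) hn
  set s := (β - α) / n
  have hs : 0 < s := div_pos (sub_pos.2 hlt) hn0
  have hsn : n * s = β - α := mul_div_cancel₀ _ hn0.ne'
  have hsδ : s < δ := by rwa [div_lt_comm₀ hn0 hδ]
  have key : ∀ i : ℕ, i ≤ n → r α (α + i * s) := by
    intro i
    induction i with
    | zero => intro _; simpa using hr α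
    | succ i ih =>
      intro hi
      have hi' : ((i + 1 : ℕ) : ℝ) * s ≤ n * s := by gcongr
      push_cast at hi' ⊢
      refine ht _ _ _ (ih (by omega)) (h _ _ ?_ ?_ ?_ ?_)
      · have : 0 ≤ (i : ℝ) * s := by positivity
        linarith
      · linarith
      · linarith
      · linarith
  have := key n le_rfl
  rwa [hsn, add_sub_cancel] at this

lemma exists_forall_dist_lt_mem {G : Set (RVec 3)} (hG : Convex ℝ G) (hO : IsOpen G)
    {f : ℝ →ᵃ[ℝ] RVec 3} {α β : ℝ} (hα : f α ∈ G) (hβ : f β ∈ G) :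
    ∃ δ > 0, ∀ x ∈ Icc α β, ∀ w, dist w (f x) < δ → w ∈ G := by
  have hK : f '' Icc α β ⊆ G := by
    rintro _ ⟨x, hx, rfl⟩
    exact (hG.affine_preimage f).ordConnected.out hα hβ hx
  obtain ⟨δ, hδ, h⟩ := (isCompact_Icc.image
    f.continuous_of_finiteDimensional).exists_thickening_subset_open hO hK
  exact ⟨δ, hδ, fun x hx w hw => h (Metric.mem_thickening_iff.2 ⟨_, mem_image_of_mem f hx, hw⟩)⟩

lemma isOrderedPoint_vec {a b c : ℝ} (ha : 0 ≤ a) (hab : a ≤ b) (hbc : b ≤ c) :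
    ∃ q, IsOrderedPoint ![a, b, c] q :=
  ⟨a + b + c, isOrderedPoint_iff.2 (by simp [*])⟩

lemma dist_vec_lt {a b c a' b' c' δ : ℝ} (hδ : 0 < δ) (h0 : |a - a'| < δ) (h1 : |b - b'| < δ)
    (h2 : |c - c'| < δ) : dist (![a, b, c] : RVec 3) ![a', b', c'] < δ := by
  rw [dist_pi_lt_iff hδ]
  intro i
  fin_cases i <;> simpa [Real.dist_eq]

/-- One can move from `(a, a, c)` to `(a', a', c)` remaining close to the segment between them. -/
lemma exists_joins_lower {G : Set (RVec 3)} (hG : Convex ℝ G) (hO : IsOpen G) {a a' c : ℝ}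
    (ha : 0 ≤ a) (haa' : a ≤ a') (hc : a' ≤ c) (hm : ![a, a, c] ∈ G) (hm' : ![a', a', c] ∈ G)
    (l : Fin 3) : ∃ l', Joins G ∅ ![a, a, c] l ![a', a', c] l' := by
  let f : ℝ →ᵃ[ℝ] RVec 3 := AffineMap.lineMap ![0, 0, c] ![1, 1, c]
  have hf : ∀ x, f x = ![x, x, c] := by
    intro x
    ext i
    fin_cases i <;> simp [f, AffineMap.lineMap_apply]
  obtain ⟨δ, hδ, h⟩ := exists_forall_dist_lt_mem hG hO (f := f) (α := a) (β := a')
    (by rwa [hf]) (by rwa [hf])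
  refine rel_of_forall_close
    (r := fun x y => ∀ l, ∃ l', Joins G ∅ ![x, x, c] l ![y, y, c] l')
    (fun x l => ⟨l, Joins.refl _ _ _⟩) (fun x y z hxy hyz l => ?_) haa' hδ
    (fun x y hx hxy hy hyx l => ?_) l
  · obtain ⟨l', h1⟩ := hxy l
    obtain ⟨l'', h2⟩ := hyz l'
    exact ⟨l'', by simpa using h1.trans h2⟩
  have habs : |y - x| < δ := by rwa [abs_of_pos (by linarith)]
  have m1 : ![x, x, c] ∈ G := h x ⟨hx, by linarith⟩ _ (by simpa [hf] using hδ)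
  have m2 : ![x, y, c] ∈ G := h x ⟨hx, by linarith⟩ _
    (by rw [hf]; exact dist_vec_lt hδ (by simpa) habs (by simpa))
  have m3 : ![y, y, c] ∈ G := h y ⟨by linarith, hy⟩ _ (by simpa [hf] using hδ)
  have o1 := isOrderedPoint_vec (by linarith : 0 ≤ x) le_rfl (by linarith : x ≤ c)
  have o2 := isOrderedPoint_vec (by linarith : 0 ≤ x) hxy.le (by linarith : y ≤ c)
  have o3 := isOrderedPoint_vec (by linarith : 0 ≤ y) le_rfl (by linarith : y ≤ c)
  have j1 : Joins G ∅ ![x, x, c] l ![x, y, c] 1 := by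
    refine joins_add_smul hG (sub_pos.2 hxy) ?_ m1 m2 o1 o2 ?_
    · ext i
      fin_cases i <;> simp [eVec]
    · intro hl i _ hi
      obtain rfl : l = 0 := by omega
      obtain rfl | rfl : i = 0 ∨ i = 1 := by omega
      all_goals simp
  have j2 : Joins G ∅ ![x, y, c] 1 ![y, y, c] 0 := by
    refine joins_add_smul hG (sub_pos.2 hxy) ?_ m2 m3 o2 o3 ?_
    · ext i
      fin_cases i <;> simp [eVec]
    · intro hl
      exact absurd hl (by decide)
  exact ⟨0, by simpa using j1.trans j2⟩

lemma isFree_one (a c : ℝ) : IsFree ![a, c, c] 1 := by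
  intro k _ i hi _
  obtain rfl | rfl : i = 1 ∨ i = 2 := by omega
  all_goals simp

/-- One can move from `(a, c, c)` to `(a, c', c')` remaining close to the segment between them. -/
lemma exists_joins_upper {G : Set (RVec 3)} (hG : Convex ℝ G) (hO : IsOpen G) {a c c' : ℝ}
    (ha : 0 ≤ a) (hac : a ≤ c) (hc : c ≤ c') (hm : ![a, c, c] ∈ G) (hm' : ![a, c', c'] ∈ G)
    {l : Fin 3} (hl : IsFree ![a, c, c] l) :
    ∃ l', IsFree ![a, c', c'] l' ∧ Joins G ∅ ![a, c, c] l ![a, c', c'] l' := by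
  let f : ℝ →ᵃ[ℝ] RVec 3 := AffineMap.lineMap ![a, 0, 0] ![a, 1, 1]
  have hf : ∀ x, f x = ![a, x, x] := by
    intro x
    ext i
    fin_cases i <;> simp [f, AffineMap.lineMap_apply]
  obtain ⟨δ, hδ, h⟩ := exists_forall_dist_lt_mem hG hO (f := f) (α := c) (β := c')
    (by rwa [hf]) (by rwa [hf])
  refine rel_of_forall_close
    (r := fun x y => ∀ l, IsFree ![a, x, x] l →
      ∃ l', IsFree ![a, y, y] l' ∧ Joins G ∅ ![a, x, x] l ![a, y, y] l')
    (fun x l hl => ⟨l, hl, Joins.refl _ _ _⟩) (fun x y z hxy hyz l hl => ?_) hc hδ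
    (fun x y hx hxy hy hyx l hl => ?_) l hl
  · obtain ⟨l', hl', h1⟩ := hxy l hl
    obtain ⟨l'', hl'', h2⟩ := hyz l' hl'
    exact ⟨l'', hl'', by simpa using h1.trans h2⟩
  have habs : |y - x| < δ := by rwa [abs_of_pos (by linarith)]
  have m1 : ![a, x, x] ∈ G := h x ⟨hx, by linarith⟩ _ (by simpa [hf] using hδ)
  have m2 : ![a, x, y] ∈ G := h x ⟨hx, by linarith⟩ _
    (by rw [hf]; exact dist_vec_lt hδ (by simpa) (by simpa) habs)
  have m3 : ![a, y, y] ∈ G := h y ⟨by linarith, hy⟩ _ (by simpa [hf] using hδ)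
  have o1 := isOrderedPoint_vec ha (hac.trans hx) (le_refl x)
  have o2 := isOrderedPoint_vec ha (hac.trans hx) hxy.le
  have o3 := isOrderedPoint_vec ha (hac.trans (hx.trans hxy.le)) (le_refl y)
  have j1 : Joins G ∅ ![a, x, x] l ![a, x, y] 2 := by
    refine joins_add_smul hG (sub_pos.2 hxy) ?_ m1 m2 o1 o2 (hl 2)
    ext i
    fin_cases i <;> simp [eVec]
  have j2 : Joins G ∅ ![a, x, y] 2 ![a, y, y] 1 := by
    refine joins_add_smul hG (sub_pos.2 hxy) ?_ m2 m3 o2 o3 ?_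
    · ext i
      fin_cases i <;> simp [eVec]
    · intro hl
      exact absurd hl (by decide)
  exact ⟨1, isFree_one a y, by simpa using j1.trans j2⟩

/-- One can go straight from `(a, a, c)` to `(a, c, c)`. -/
lemma exists_joins_cross {G : Set (RVec 3)} (hG : Convex ℝ G) {a c : ℝ}
    (ha : 0 ≤ a) (hac : a ≤ c) (hm : ![a, a, c] ∈ G) (hm' : ![a, c, c] ∈ G) (l : Fin 3) :
    ∃ l', IsFree ![a, c, c] l' ∧ Joins G ∅ ![a, a, c] l ![a, c, c] l' := by
  rcases hac.eq_or_lt with rfl | hlt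
  · refine ⟨l, fun k _ i _ _ => ?_, Joins.refl _ _ _⟩
    have : ∀ i : Fin 3, (![a, a, a] : RVec 3) i = a := by
      intro i
      fin_cases i <;> simp
    rw [this, this]
  · refine ⟨1, isFree_one a c, joins_add_smul hG (sub_pos.2 hlt) ?_ hm hm'
      (isOrderedPoint_vec ha le_rfl hac) (isOrderedPoint_vec ha hac le_rfl) ?_⟩
    · ext i
      fin_cases i <;> simp [eVec]
    · intro hl i _ hi
      obtain rfl : l = 0 := by omega
      obtain rfl | rfl : i = 0 ∨ i = 1 := by omega
      all_goals simp

/-- Two crossings can be connected: from the lower point of the first one, one reaches the upper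
point of a dilate of the second one. -/
lemma exists_joins_crossing {G : Set (RVec 3)} (hG : Convex ℝ G) (hO : IsOpen G)
    (hGs : ∀ w ∈ G, ∀ r : ℝ, 0 < r → r • w ∈ G) {a c a' c' : ℝ}
    (ha : 0 < a) (hac : a ≤ c) (hm : ![a, a, c] ∈ G) (hM : ![a, c, c] ∈ G)
    (ha' : 0 < a') (hac' : a' ≤ c') (hm' : ![a', a', c'] ∈ G) (hM' : ![a', c', c'] ∈ G)
    (l : Fin 3) :
    ∃ r : ℝ, 0 < r ∧ ∃ l', IsFree (r • ![a', c', c']) l' ∧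
      Joins G ∅ ![a, a, c] l (r • ![a', c', c']) l' := by
  have hc : 0 < c := ha.trans_le hac
  have hc' : 0 < c' := ha'.trans_le hac'
  have hsmul : ∀ r x y z : ℝ, r • (![x, y, z] : RVec 3) = ![r * x, r * y, r * z] := by
    intro r x y z
    ext i
    fin_cases i <;> simp
  rcases le_total (a * c') (a' * c) with hle | hle
  · have hr : 0 < c / c' := div_pos hc hc'
    have hrc : c / c' * c' = c := div_mul_cancel₀ _ hc'.ne'
    have hm1 := hGs _ hm' _ hr
    have hM1 := hGs _ hM' _ hr
    refine ⟨c / c', hr, ?_⟩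
    rw [hsmul, hrc] at hm1 hM1 ⊢
    have h1 : a ≤ c / c' * a' := by
      rw [div_mul_eq_mul_div, le_div_iff₀ hc']; linarith
    have h2 : c / c' * a' ≤ c := by
      calc c / c' * a' ≤ c / c' * c' := by gcongr
        _ = c := hrc
    obtain ⟨l₁, j1⟩ := exists_joins_lower hG hO ha.le h1 h2 hm hm1 l
    obtain ⟨l₂, hl₂, j2⟩ := exists_joins_cross hG (ha.le.trans h1) h2 hm1 hM1 l₁
    exact ⟨l₂, hl₂, by simpa using j1.trans j2⟩
  · have hr : 0 < a / a' := div_pos ha ha'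
    have hra : a / a' * a' = a := div_mul_cancel₀ _ ha'.ne'
    have hM1 := hGs _ hM' _ hr
    refine ⟨a / a', hr, ?_⟩
    rw [hsmul, hra] at hM1 ⊢
    have h1 : c ≤ a / a' * c' := by
      rw [div_mul_eq_mul_div, le_div_iff₀ ha']; linarith
    obtain ⟨l₁, hl₁, j1⟩ := exists_joins_cross hG ha.le hac hm hM l
    obtain ⟨l₂, hl₂, j2⟩ := exists_joins_upper hG hO ha.le hac h1 hM hM1 hl₁
    exact ⟨l₂, hl₂, by simpa using j1.trans j2⟩

lemma IsArc.isOrderedPoint {G : Set (RVec 3)} {W : ℝ → RVec 3} {a b : ℝ} {l l' : Fin 3}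
    (h : IsArc G W a b l l') {q : ℝ} (hq : q ∈ Icc a b) : IsOrderedPoint (W q) q := by
  rcases hq.1.eq_or_lt with rfl | h1
  · exact h.left
  rcases hq.2.eq_or_lt with rfl | h2
  · exact h.right
  exact (h.interior q ⟨h1, h2⟩).1

/-- The open convex cone of the points `w` with `T_j(w) > (z_j - ε) (w_1 + w_2 + w_3)`. -/
def region {m : ℕ} (T : RVec 3 →ₗ[ℝ] RVec m) (z : RVec m) (ε : ℝ) : Set (RVec 3) :=
  {w | ∀ j, (z j - ε) * ∑ i, w i < T w j}

section region

variable {m : ℕ} (T : RVec 3 →ₗ[ℝ] RVec m) (z : RVec m) (ε : ℝ)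

lemma convex_region : Convex ℝ (region T z ε) := by
  intro v hv w hw a b ha hb hab j
  have h1 := hv j
  have h2 := hw j
  simp only [map_add, map_smul, Pi.add_apply, Pi.smul_apply, smul_eq_mul, Finset.sum_add_distrib,
    ← Finset.mul_sum]
  rcases ha.eq_or_lt with rfl | ha
  · obtain rfl : b = 1 := by linarith
    simpa using h2
  · nlinarith [mul_lt_mul_of_pos_left h1 ha, mul_le_mul_of_nonneg_left h2.le hb]

lemma isOpen_region : IsOpen (region T z ε) := by
  have : region T z ε = ⋂ j, {w | (z j - ε) * ∑ i, w i < T w j} := by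
    ext w
    simp [region]
  rw [this]
  refine isOpen_iInter_of_finite fun j => isOpen_lt (by fun_prop) ?_
  exact (continuous_apply j).comp T.continuous_of_finiteDimensional

lemma smul_mem_region {w : RVec 3} (hw : w ∈ region T z ε) {r : ℝ} (hr : 0 < r) :
    r • w ∈ region T z ε := by
  intro j
  have h := mul_lt_mul_of_pos_left (hw j) hr
  simp only [map_smul, Pi.smul_apply, smul_eq_mul, ← Finset.mul_sum]
  linarith

variable {T z ε}

lemma region_mono {z' : RVec m} {ε' : ℝ} (hz : z' ≤ z) (hε : ε ≤ ε') {w : RVec 3} {q : ℝ}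
    (hw : IsOrderedPoint w q) (h : w ∈ region T z ε) : w ∈ region T z' ε' := by
  intro j
  refine lt_of_le_of_lt ?_ (h j)
  have : 0 ≤ ∑ i, w i := Finset.sum_nonneg fun i _ => hw.1 i
  have := hz j
  gcongr

end region

/-- For every `j`, the limit inferior of `T_j(P(q)) / q` at infinity is `z_j`. -/
def HasLiminf {m : ℕ} (T : RVec 3 →ₗ[ℝ] RVec m) (P : ℝ → RVec 3) (z : RVec m) : Prop :=
  ∀ ε > 0, (∀ᶠ q in atTop, P q ∈ region T z ε) ∧
    ∀ j, ∃ᶠ q in atTop, T (P q) j < (z j + ε) * q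

/-- From any point `(a, a, c)`, one can reach and follow for a long time a dilate of a given proper
system. -/
lemma exists_stage {m : ℕ} {T : RVec 3 →ₗ[ℝ] RVec m} {P : ℝ → RVec 3} {a₀ : ℝ} {z z' : RVec m}
    (hP : IsProperTail P a₀) (hz : HasLiminf T P z) (hz' : z' ≤ z) {ε ε' : ℝ} (hε : 0 < ε)
    (hε' : 0 < ε') (N : ℝ) {a c : ℝ} (ha : 0 < a) (hac : a ≤ c)
    (hm : ![a, a, c] ∈ region T z' ε) (hM : ![a, c, c] ∈ region T z' ε) (l : Fin 3) :
    ∃ a' c' l' W, a + 1 ≤ a' ∧ N ≤ a' ∧ a' ≤ c' ∧ ![a', a', c'] ∈ region T z' ε' ∧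
      ![a', c', c'] ∈ region T z' ε' ∧
      IsArc (region T z' ε) W (a + a + c) (a' + a' + c') l l' ∧ W (a + a + c) = ![a, a, c] ∧
      W (a' + a' + c') = ![a', a', c'] ∧
      ∀ j, ∃ q ∈ Icc (a + a + c) (a' + a' + c'), T (W q) j < (z j + ε') * q := by
  set G := region T z' ε
  have hvec : ∀ w : RVec 3, w = ![w 0, w 1, w 2] := by
    intro w
    ext i
    fin_cases i <;> rfl
  have hevent : ∀ δ > 0, ∀ M, ∃ u v, M ≤ u ∧ a₀ < u ∧ u ≤ v ∧ 0 < P u 0 ∧ P u 0 ≤ P u 2 ∧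
      P u = ![P u 0, P u 0, P u 2] ∧ P v = ![P u 0, P u 2, P u 2] ∧
      ∀ q ≥ u, P q ∈ region T z' δ := by
    intro δ hδ M
    obtain ⟨Q, hQ⟩ := eventually_atTop.1 ((hz δ hδ).1.and (hP.eventually_lt_apply 0 0))
    obtain ⟨u, v, hu, hau, huv, h1, h2, h3, h4⟩ := hP.exists_crossing (max M Q)
    have hQu : Q ≤ u := (le_max_right _ _).trans hu
    have hle := (hP.1 u hau).le
    refine ⟨u, v, (le_max_left _ _).trans hu, hau, huv, (hQ u hQu).2, hle.2.1.trans hle.2.2.1,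
      ?_, ?_, fun q hq => region_mono hz' le_rfl (hP.1 q (lt_of_lt_of_le hau hq)).1
        (hQ q (hQu.trans hq)).1⟩
    · conv_lhs => rw [hvec (P u), ← h1]
    · conv_lhs => rw [hvec (P v), h2, ← h3, ← h4]
  obtain ⟨u, v, -, hau, huv, hu0, hu2, hPu, hPv, hG⟩ := hevent ε hε 0
  have hmu := hG u le_rfl
  have hmv := hG v huv
  rw [hPu] at hmu
  rw [hPv] at hmv
  obtain ⟨r, hr, l₁, hl₁, j₁⟩ := exists_joins_crossing (convex_region T z' ε)
    (isOpen_region T z' ε) (fun w hw r hr => smul_mem_region T z' ε hw hr) ha hac hm hM hu0 hu2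
    hmu hmv l
  rw [← hPv] at hl₁ j₁
  have hav : a₀ < v := lt_of_lt_of_le hau huv
  have hwit : ∀ j, ∃ q > v, T (P q) j < (z j + ε') * q := by
    intro j
    obtain ⟨q, hq1, hq2⟩ := (((hz ε' hε').2 j).and_eventually (eventually_gt_atTop v)).exists
    exact ⟨q, hq2, hq1⟩
  choose q hqv hqT using hwit
  obtain ⟨M₁, hM₁⟩ := eventually_atTop.1 ((hP.eventually_lt_apply (max N (a + 1) / r) 0).and
    ((eventually_gt_atTop v).and (eventually_all.2 fun j => eventually_ge_atTop (q j))))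
  obtain ⟨u', v', hu', hau', huv', hu'0, hu'2, hPu', hPv', hG'⟩ := hevent ε' hε' M₁
  obtain ⟨hbig, hvu', hqu'⟩ := hM₁ u' hu'
  rw [div_lt_iff₀' hr] at hbig
  set P' : ℝ → RVec 3 := fun t => r • P (t / r)
  have hP' : ∀ t, P' (r * t) = r • P t := fun t => by simp [P', mul_div_cancel_left₀ _ hr.ne']
  have hsys : ∀ t > r * a₀, IsSystemAt P' t := by
    intro t ht
    have := (hP.1 (t / r) (by rwa [gt_iff_lt, lt_div_iff₀' hr])).rescale hr
    rwa [mul_div_cancel₀ _ hr.ne'] at this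
  obtain ⟨l', j₂⟩ := joins_of_isSystemAt (G := G) hsys (s := r * v) (t := r * u') (l := l₁)
    (by gcongr) (by gcongr)
    (fun t ht => smul_mem_region T z' ε (hG _ (huv.trans (by
      rw [le_div_iff₀' hr]; exact ht.1))) hr) (by rwa [hP'])
  rw [hP', hP'] at j₂
  have hsmul : ∀ x y z : ℝ, r • (![x, y, z] : RVec 3) = ![r * x, r * y, r * z] := by
    intro x y z
    ext i
    fin_cases i <;> simp
  have hend : r • P u' = ![r * P u' 0, r * P u' 0, r * P u' 2] := by rw [← hsmul, ← hPu']
  have hend' : r • P v' = ![r * P u' 0, r * P u' 2, r * P u' 2] := by rw [← hsmul, ← hPv']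
  refine ⟨r * P u' 0, r * P u' 2, l', ?_⟩
  have hlast : ∀ j, ∃ w ∈ P' '' Icc (r * v) (r * u'), T w j < (z j + ε') * ∑ i, w i := by
    intro j
    refine ⟨P' (r * q j), ⟨_, ⟨by gcongr; exact (hqv j).le, by gcongr; exact hqu' j⟩, rfl⟩, ?_⟩
    have hs := (hP.1 (q j) (hav.trans (hqv j))).1.2.2
    have := mul_lt_mul_of_pos_left (hqT j) hr
    simp only [hP', map_smul, Pi.smul_apply, smul_eq_mul, ← Finset.mul_sum, hs]
    linarith
  have hN : max N (a + 1) ≤ r * P u' 0 := hbig.le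
  rcases j₁.trans j₂ with ⟨h, -, -⟩ | ⟨W, b, b', hW, hWb, hWb', hV⟩
  · rw [hend] at h
    have := congrFun h 0
    simp at this
    linarith [le_max_right N (a + 1)]
  obtain rfl : b = a + a + c := by
    rw [← hW.left.2.2, hWb, Fin.sum_univ_three]
    simp
  obtain rfl : b' = r * P u' 0 + r * P u' 0 + r * P u' 2 := by
    rw [← hW.right.2.2, hWb', hend, Fin.sum_univ_three]
    simp
  refine ⟨W, (le_max_right _ _).trans hN, (le_max_left _ _).trans hN, by gcongr, ?_, ?_, hW, hWb,
    by rw [hWb', hend], ?_⟩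
  · rw [← hend]
    exact smul_mem_region T z' ε' (hG' u' le_rfl) hr
  · rw [← hend']
    exact smul_mem_region T z' ε' (hG' v' huv') hr
  · intro j
    obtain ⟨w, hw, hwj⟩ := hlast j
    obtain ⟨t, ht, rfl⟩ := hV (Or.inr hw)
    refine ⟨t, ht, ?_⟩
    rwa [(hW.isOrderedPoint ht).2.2] at hwj

/-- Infinitely many consecutive arcs form a system on a half-line. -/
lemma exists_glue {G : ℕ → Set (RVec 3)} {W : ℕ → ℝ → RVec 3} {b : ℕ → ℝ} {l : ℕ → Fin 3}
    (hb : StrictMono b) (hb' : Tendsto b atTop atTop)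
    (h : ∀ n, IsArc (G n) (W n) (b n) (b (n + 1)) (l n) (l (n + 1)))
    (hW : ∀ n, W n (b (n + 1)) = W (n + 1) (b (n + 1))) :
    ∃ R : ℝ → RVec 3, (∀ n, EqOn R (W n) (Icc (b n) (b (n + 1)))) ∧
      (∀ q > b 0, IsSystemAt R q) ∧ ∀ q ≥ b 0, ∃ n, q ∈ Ico (b n) (b (n + 1)) := by
  classical
  have hex : ∀ t, ∃ n, t < b (n + 1) := fun t =>
    ((hb'.comp (tendsto_add_atTop_nat 1)).eventually_gt_atTop t).exists
  set R : ℝ → RVec 3 := fun t => W (Nat.find (hex t)) t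
  have hfind : ∀ n, ∀ t ∈ Ico (b n) (b (n + 1)), Nat.find (hex t) = n := by
    intro n t ht
    refine (Nat.find_eq_iff _).2 ⟨ht.2, fun k hk => not_lt.2 (le_trans ?_ ht.1)⟩
    exact hb.monotone hk
  have hR : ∀ n, EqOn R (W n) (Icc (b n) (b (n + 1))) := by
    intro n t ht
    rcases ht.2.lt_or_eq with hlt | rfl
    · simp only [R, hfind n t ⟨ht.1, hlt⟩]
    · simp only [R, hfind (n + 1) _ ⟨le_rfl, hb (Nat.lt_succ_self _)⟩, hW]
  have hloc : ∀ q ≥ b 0, ∃ n, q ∈ Ico (b n) (b (n + 1)) := by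
    intro q hq
    refine ⟨Nat.find (hex q), ?_, Nat.find_spec (hex q)⟩
    rcases Nat.eq_zero_or_pos (Nat.find (hex q)) with h0 | h0
    · rwa [h0]
    · have := Nat.find_min (hex q) (m := Nat.find (hex q) - 1) (by omega)
      rwa [Nat.sub_add_cancel h0, not_lt] at this
  refine ⟨R, hR, fun q hq => ?_, hloc⟩
  obtain ⟨n, hn⟩ := hloc q hq.le
  rcases hn.1.lt_or_eq with hlt | rfl
  · exact (h n).isSystemAt_of_eqOn (hR n) ⟨hlt, hn.2⟩
  · obtain ⟨k, rfl⟩ := Nat.exists_eq_succ_of_ne_zero (n := n) (by rintro rfl; exact lt_irrefl _ hq)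
    exact (h k).isSystemAt_junction (h (k + 1)) (hR k) (hR (k + 1))

lemma exists_seq_of_forall_exists {σ : Type*} {I : ℕ → σ → Prop} {r : ℕ → σ → σ → Prop}
    {s₀ : σ} (h₀ : I 0 s₀) (h : ∀ n s, I n s → ∃ s', I (n + 1) s' ∧ r n s s') :
    ∃ s : ℕ → σ, (∀ n, I n (s n)) ∧ ∀ n, r n (s n) (s (n + 1)) := by
  choose! f hf using h
  let s : ℕ → σ := fun n => Nat.rec s₀ (fun n s => f n s) n
  have hs : ∀ n, I n (s n) := by
    intro n
    induction n with
    | zero => exact h₀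
    | succ n ih => exact (hf n _ ih).1
  exact ⟨s, hs, fun n => (hf n _ (hs n)).2⟩

/-- The spectrum is closed under minimum, in terms of systems on open half-lines. -/
lemma exists_hasLiminf_min {m : ℕ} {T : RVec 3 →ₗ[ℝ] RVec m} {P Q : ℝ → RVec 3} {a b : ℝ}
    {x y : RVec m} (hP : IsProperTail P a) (hQ : IsProperTail Q b) (hx : HasLiminf T P x)
    (hy : HasLiminf T Q y) :
    ∃ R c, 0 ≤ c ∧ IsProperTail R c ∧ HasLiminf T R (fun j => min (x j) (y j)) := by
  set z : RVec m := fun j => min (x j) (y j)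
  have hzx : z ≤ x := fun j => min_le_left _ _
  have hzy : z ≤ y := fun j => min_le_right _ _
  set e : ℕ → ℝ := fun n => 1 / ((n : ℝ) + 1)
  have he : ∀ n, 0 < e n := fun n => Nat.one_div_pos_of_nat
  let tm : ℝ × ℝ × Fin 3 → ℝ := fun s => s.1 + s.1 + s.2.1
  let pt : ℝ × ℝ × Fin 3 → RVec 3 := fun s => ![s.1, s.1, s.2.1]
  let I : ℕ → ℝ × ℝ × Fin 3 → Prop := fun n s => 0 < s.1 ∧ (n : ℝ) ≤ s.1 ∧ s.1 ≤ s.2.1 ∧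
    pt s ∈ region T z (e n) ∧ ![s.1, s.2.1, s.2.1] ∈ region T z (e n)
  let r : ℕ → ℝ × ℝ × Fin 3 → ℝ × ℝ × Fin 3 → Prop := fun n s s' => ∃ W,
    IsArc (region T z (e n)) W (tm s) (tm s') s.2.2 s'.2.2 ∧ W (tm s) = pt s ∧
      W (tm s') = pt s' ∧
      ∀ j, ∃ q ∈ Icc (tm s) (tm s'),
        T (W q) j < ((if Even n then x j else y j) + e (n + 1)) * q
  have hstart : ∃ s₀, I 0 s₀ := by
    obtain ⟨M, hM⟩ := eventually_atTop.1
      ((hx (e 0) (he 0)).1.and (hP.eventually_lt_apply 0 0))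
    obtain ⟨u, v, hu, hau, huv, h1, h2, h3, h4⟩ := hP.exists_crossing M
    have hle := (hP.1 u hau).le
    refine ⟨(P u 0, P u 2, 0), (hM u hu).2, by simpa using hle.1, hle.2.1.trans hle.2.2.1, ?_, ?_⟩
    · have : pt (P u 0, P u 2, 0) = P u := by
        ext i
        fin_cases i <;> simp [pt, h1]
      rw [this]
      exact region_mono hzx le_rfl (hP.1 u hau).1 (hM u hu).1
    · have : ![P u 0, P u 2, P u 2] = P v := by
        ext i
        fin_cases i <;> simp [h2, h3, h4]
      rw [this]
      exact region_mono hzx le_rfl (hP.1 v (lt_of_lt_of_le hau huv)).1 (hM v (hu.trans huv)).1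
  have hstep : ∀ n s, I n s → ∃ s', I (n + 1) s' ∧ r n s s' := by
    rintro n ⟨a, c, l⟩ ⟨ha, -, hac, hm, hM⟩
    by_cases hn : Even n
    · obtain ⟨a', c', l', W, h1, h2, h3, h4, h5, h6, h7, h8, h9⟩ :=
        exists_stage hP hx hzx (he n) (he (n + 1)) (n + 1 : ℕ) ha hac hm hM l
      exact ⟨(a', c', l'), ⟨by dsimp only at *; linarith, h2, h3, h4, h5⟩,
        W, h6, h7, h8, by simpa only [hn, if_true] using h9⟩
    · obtain ⟨a', c', l', W, h1, h2, h3, h4, h5, h6, h7, h8, h9⟩ :=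
        exists_stage hQ hy hzy (he n) (he (n + 1)) (n + 1 : ℕ) ha hac hm hM l
      exact ⟨(a', c', l'), ⟨by dsimp only at *; linarith, h2, h3, h4, h5⟩,
        W, h6, h7, h8, by simpa only [hn, if_false] using h9⟩
  obtain ⟨s₀, hs₀⟩ := hstart
  obtain ⟨s, hI, hr⟩ := exists_seq_of_forall_exists hs₀ hstep
  choose W hW hW1 hW2 hWT using hr
  have htm : ∀ n : ℕ, (n : ℝ) ≤ tm (s n) := by
    intro n
    obtain ⟨h1, h2, h3, -⟩ := hI n
    simp only [tm]
    linarith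
  have hmono : StrictMono fun n => tm (s n) := strictMono_nat_of_lt_succ fun n => (hW n).lt
  have htend : Tendsto (fun n => tm (s n)) atTop atTop :=
    tendsto_atTop_mono htm tendsto_natCast_atTop_atTop
  obtain ⟨R, hR, hsys, hloc⟩ := exists_glue (b := fun n => tm (s n)) (l := fun n => (s n).2.2)
    hmono htend hW fun n => (hW2 n).trans (hW1 (n + 1)).symm
  refine ⟨R, tm (s 0), by simpa using htm 0, ⟨hsys, fun M => ?_⟩, fun ε hε => ?_⟩
  · obtain ⟨n, hn⟩ := exists_nat_gt M
    refine ⟨tm (s (n + 1)), hmono (Nat.succ_pos n), ?_⟩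
    rw [hR (n + 1) ⟨le_rfl, (hW (n + 1)).lt.le⟩, hW1]
    have := (hI (n + 1)).2.1
    push_cast at this
    simp only [pt, Matrix.cons_val_zero]
    linarith
  obtain ⟨n₀, hn₀⟩ := exists_nat_one_div_lt hε
  have hen : ∀ n ≥ n₀, e n ≤ ε := fun n hn => (Nat.one_div_le_one_div hn).trans hn₀.le
  constructor
  · filter_upwards [eventually_ge_atTop (tm (s n₀))] with q hq
    obtain ⟨n, hn⟩ := hloc q ((hmono.monotone (Nat.zero_le n₀)).trans hq)
    have hnn : n₀ ≤ n := by
      by_contra! hlt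
      exact absurd (hn.2.trans_le (hmono.monotone (Nat.succ_le_of_lt hlt))) (not_lt.2 hq)
    have hq' := Ico_subset_Icc_self hn
    rw [hR n hq']
    exact region_mono le_rfl (hen n hnn) ((hW n).isOrderedPoint hq') ((hW n).mem q hq')
  · intro j
    rw [frequently_atTop]
    intro B
    obtain ⟨k, hk⟩ := exists_nat_ge B
    obtain ⟨n, hn1, hn2, hn3⟩ : ∃ n, n₀ ≤ n ∧ k ≤ n ∧ (if Even n then x j else y j) = z j := by
      rcases min_choice (x j) (y j) with h | h
      · exact ⟨2 * (n₀ + k), by omega, by omega, by rw [if_pos (even_two_mul _)]; exact h.symm⟩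
      · exact ⟨2 * (n₀ + k) + 1, by omega, by omega, by
          rw [if_neg (Nat.not_even_iff_odd.2 (odd_two_mul_add_one _))]; exact h.symm⟩
    obtain ⟨q, hq, hqT⟩ := hWT n j
    have hkn : (k : ℝ) ≤ n := by exact_mod_cast hn2
    have hq0 : 0 ≤ q := ((Nat.cast_nonneg n).trans (htm n)).trans hq.1
    refine ⟨q, hk.trans (hkn.trans ((htm n).trans hq.1)), ?_⟩
    rw [hR n hq]
    rw [hn3] at hqT
    have := hen (n + 1) (by omega)
    exact hqT.trans_le (by gcongr)

lemma IsProperSys.exists_isProperTail {I : Set ℝ} {P : ℝ → RVec 3} (h : IsProperSys 3 I P) :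
    ∃ a, Ioi a ⊆ I ∧ IsProperTail P a := by
  obtain ⟨⟨hI0, hIc, hIn, hP⟩, hunb⟩ := h
  obtain ⟨a, ha⟩ := hIn
  have haI := interior_subset ha
  have hlarge : ∀ M, ∃ q ∈ I, M < q ∧ M < P q 0 := by
    intro M
    obtain ⟨q, hq, hM⟩ := hunb M
    refine ⟨q, hq, ?_, hM 0⟩
    obtain ⟨⟨h0, -, hs⟩, -⟩ := hP q hq
    rw [Fin.sum_univ_three] at hs
    linarith [hM 0, h0 1, h0 2]
  have hsub : Ioi a ⊆ I := by
    intro q hq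
    obtain ⟨q', hq', hlt, -⟩ := hlarge q
    exact hIc.out haI hq' ⟨le_of_lt hq, hlt.le⟩
  refine ⟨a, hsub, fun q hq => ?_, fun M => ?_⟩
  · have hint : q ∈ interior I := interior_maximal hsub isOpen_Ioi hq
    obtain ⟨h1, ε, hε, k, l, hl, hk, hc⟩ := hP q (hsub hq)
    refine ⟨h1, k, l, ?_, ?_, fun hlk i hi hi' => hc hint hlk i hi hi'⟩
    · filter_upwards [Icc_mem_nhdsLE (by linarith : q - ε < q),
        mem_nhdsWithin_of_mem_nhds (Ioi_mem_nhds hq)] with t ht ht'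
      exact hl t ⟨hsub ht', ht⟩
    · filter_upwards [Icc_mem_nhdsGE (by linarith : q < q + ε),
        mem_nhdsWithin_of_mem_nhds (Ioi_mem_nhds hq)] with t ht ht'
      exact hk t ⟨hsub ht', ht⟩
  · obtain ⟨q, -, h1, h2⟩ := hlarge (max M a)
    exact ⟨q, (le_max_right _ _).trans_lt h1, (le_max_left _ _).trans_lt h2⟩

lemma IsProperTail.isProperSys {P : ℝ → RVec 3} {a : ℝ} (ha : 0 ≤ a) (h : IsProperTail P a) :
    IsProperSys 3 (Ici (a + 1)) P := by
  refine ⟨⟨Ici_subset_Ici.2 (by linarith), ordConnected_Ici, ?_, fun q hq => ?_⟩, fun M => ?_⟩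
  · rw [interior_Ici]
    exact nonempty_Ioi
  · obtain ⟨h1, k, l, hl, hk, hc⟩ := h.1 q (by rw [mem_Ici] at hq; linarith)
    obtain ⟨u, hu, hu'⟩ := mem_nhdsLE_iff_exists_Icc_subset.1 hl
    obtain ⟨v, hv, hv'⟩ := mem_nhdsGE_iff_exists_Icc_subset.1 hk
    refine ⟨h1, min (q - u) (v - q), lt_min (by linarith) (by linarith), k, l,
      fun t ht => hu' ⟨?_, ht.2.2⟩, fun t ht => hv' ⟨ht.2.1, ?_⟩,
      fun _ hlk i hi hi' => hc hlk i hi hi'⟩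
    · linarith [ht.2.1, min_le_left (q - u) (v - q)]
    · linarith [ht.2.2, min_le_right (q - u) (v - q)]
  · exact ((eventually_all.2 (h.eventually_lt_apply M)).and
      (eventually_ge_atTop (a + 1))).exists.imp fun q hq => ⟨hq.2, hq.1⟩

lemma muT_eq_iff_hasLiminf {m : ℕ} {T : RVec 3 →ₗ[ℝ] RVec m} {I : Set ℝ} {P : ℝ → RVec 3} {a : ℝ}
    (hI : Ioi a ⊆ I) (hP : IsProperTail P a) {z : RVec m} :
    muT 3 m T I P = z ↔ HasLiminf T P z := by
  have hfilter : atTop ⊓ 𝓟 I = atTop :=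
    inf_eq_left.2 (le_principal_iff.2 (mem_of_superset (Ioi_mem_atTop a) hI))
  have hev : ∀ᶠ q in atTop, IsOrderedPoint (P q) q ∧ 0 < q := by
    filter_upwards [eventually_gt_atTop a, eventually_gt_atTop 0] with q hq hq0
    exact ⟨(hP.1 q hq).1, hq0⟩
  have hbound : ∀ j, ∃ K, ∀ᶠ q in atTop, |T (P q) j / q| ≤ K := by
    intro j
    refine ⟨∑ i, |T (fun k => if i = k then 1 else 0) j|, ?_⟩
    filter_upwards [hev] with q hq
    have h1 : T (P q) j = ∑ i, P q i * T (fun k => if i = k then 1 else 0) j := by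
      rw [LinearMap.pi_apply_eq_sum_univ T (P q), Finset.sum_apply]
      rfl
    rw [abs_div, abs_of_pos hq.2, div_le_iff₀ hq.2, h1, Finset.sum_mul]
    refine (Finset.abs_sum_le_sum_abs _ _).trans (Finset.sum_le_sum fun i _ => ?_)
    rw [abs_mul, abs_of_nonneg (hq.1.1 i), mul_comm]
    gcongr
    exact (Finset.single_le_sum (fun i _ => hq.1.1 i) (Finset.mem_univ i)).trans_eq hq.1.2.2
  have hb : ∀ j, IsBoundedUnder (· ≥ ·) atTop fun q => T (P q) j / q := fun j => by
    obtain ⟨K, hK⟩ := hbound j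
    exact ⟨-K, by simpa using hK.mono fun q hq => (abs_le.1 hq).1⟩
  have hcb : ∀ j, IsCoboundedUnder (· ≥ ·) atTop fun q => T (P q) j / q := fun j => by
    obtain ⟨K, hK⟩ := hbound j
    exact IsBoundedUnder.isCoboundedUnder_ge
      ⟨K, by simpa using hK.mono fun q hq => (abs_le.1 hq).2⟩
  have hmu : ∀ j, muT 3 m T I P j = liminf (fun q => T (P q) j / q) atTop := fun j => by
    simp only [muT, hfilter]
  constructor
  · rintro rfl ε hε
    constructor
    · have : ∀ᶠ q in atTop, ∀ j, muT 3 m T I P j - ε < T (P q) j / q :=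
        eventually_all.2 fun j => eventually_lt_of_lt_liminf (by rw [← hmu]; linarith) (hb j)
      filter_upwards [this, hev] with q hq hq' j
      have h1 := hq j
      rw [lt_div_iff₀ hq'.2] at h1
      rw [hq'.1.2.2]
      exact h1
    · intro j
      have : ∃ᶠ q in atTop, T (P q) j / q < muT 3 m T I P j + ε :=
        frequently_lt_of_liminf_lt (hcb j) (by rw [← hmu]; linarith)
      refine (this.and_eventually hev).mono fun q hq => ?_
      rw [← div_lt_iff₀ hq.2.2]
      exact hq.1
  · intro h
    ext j
    rw [hmu]
    refine le_antisymm (le_of_forall_pos_le_add fun ε hε => ?_)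
      (le_of_forall_pos_le_add fun ε hε => ?_)
    · refine liminf_le_of_frequently_le ?_ (hb j)
      refine (((h ε hε).2 j).and_eventually hev).mono fun q hq => ?_
      rw [div_le_iff₀ hq.2.2]
      exact hq.1.le
    · rw [← sub_le_iff_le_add]
      refine le_liminf_of_le (hcb j) ?_
      filter_upwards [(h ε hε).1, hev] with q hq hq'
      have h1 := hq j
      rw [hq'.1.2.2] at h1
      rw [le_div_iff₀ hq'.2]
      exact h1.le

/-- **Corollary (the spectrum is closed under minimum).** For a linear map
`T : ℝ³ → ℝ^m` and points `x, y` of the spectrum `{μ_T(P) : P a proper 3-system}`,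
the coordinatewise minimum `min{x, y}` also belongs to the spectrum. -/
theorem spectrum_min_closed (m : ℕ) (T : RVec 3 → RVec m) (hT : IsLinearMap ℝ T)
    (x y : RVec m)
    (hx : x ∈ {z : RVec m | ∃ I P, IsProperSys 3 I P ∧ muT 3 m T I P = z})
    (hy : y ∈ {z : RVec m | ∃ I P, IsProperSys 3 I P ∧ muT 3 m T I P = z}) :
    (fun j => min (x j) (y j))
      ∈ {z : RVec m | ∃ I P, IsProperSys 3 I P ∧ muT 3 m T I P = z} := by
  obtain ⟨I, P, hP, hPx⟩ := hx
  obtain ⟨J, Q, hQ, hQy⟩ := hy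
  obtain ⟨a, ha, hPa⟩ := hP.exists_isProperTail
  obtain ⟨b, hb, hQb⟩ := hQ.exists_isProperTail
  obtain ⟨R, c, hc, hR, hRm⟩ := exists_hasLiminf_min (T := hT.mk') hPa hQb
    ((muT_eq_iff_hasLiminf ha hPa).1 hPx) ((muT_eq_iff_hasLiminf hb hQb).1 hQy)
  have hR' : IsProperTail R (c + 1) := ⟨fun q hq => hR.1 q (by linarith), fun M =>
    ((hR.eventually_lt_apply M 0).and (eventually_gt_atTop (c + 1))).exists.imp
      fun q hq => ⟨hq.2, hq.1⟩⟩
  exact ⟨Ici (c + 1), R, hR.isProperSys hc, (muT_eq_iff_hasLiminf Ioi_subset_Ici_self hR').2 hRm⟩
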